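/- Let p ≥ 1 and r₁,…,r_p ≥ 1, set n = r₁+⋯+r_p, and regard ℝⁿ as block-decomposed into consecutive blocks of sizes r₁,…,r_p. For τ = (τ₂,…,τ_p) ∈ (0,∞)^{p−1} set ε₁(τ) = 1 and ε_j(τ) = τ₂τ₃⋯τ_j for 2 ≤ j ≤ p, and let Ω(τ) be the block-diagonal matrix diag(ε₁(τ)I_{r₁},…,ε_p(τ)I_{r_p}). Let M′ be an n×n real symmetric positive definite matrix and set M(τ) = Ω(τ) M′ Ω(τ). Define recursively S⁽⁰⁾ = M′ and, for 1 ≤ j ≤ p−1, writing the symmetric positive definite matrix S⁽ʲ⁻¹⁾ (acting on blocks j,…,p) in block form [[J_j, B_jᵀ],[B_j, N_j]] where J_j is its block-(j,j) part, set G_j = J_j and S⁽ʲ⁾ = N_j − B_j J_j⁻¹ B_jᵀ; finally set G_p = S⁽ᵖ⁻¹⁾. Then for every κ > 0 there exist δ > 0 and C > 0, depending only on p, r₁,…,r_p and κ, such that whenever ‖M′‖ ≤ κ, ‖M′⁻¹‖ ≤ κ and max_{2≤k≤p} τ_k ≤ δ, the spectrum of M(τ), counted with multiplicity, consists exactly of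 n eigenvalues μ_{j,m} (1 ≤ j ≤ p, 1 ≤ m ≤ r_j) satisfying |μ_{j,m} − ε_j(τ)² λ_{j,m}| ≤ C ε_j(τ)² (max_k τ_k)², where λ_{j,1} ≤ ⋯ ≤ λ_{j,r_j} are the eigenvalues of G_j (all positive). -/

import Mathlib

open Matrix

noncomputable section

/-- The index set of `ℝⁿ` block-decomposed into `p` consecutive blocks of sizes `r 0, …, r (p-1)`. -/
abbrev BlockIdx (p : ℕ) (r : Fin p → ℕ) : Type := (j : Fin p) × Fin (r j)

/-- The indices belonging to the blocks `j, j+1, …` (the "tail" starting at block `k`). -/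
abbrev TailIdx (p : ℕ) (r : Fin p → ℕ) (k : ℕ) : Type :=
  {i : BlockIdx p r // k ≤ (i.1 : ℕ)}

/-- The indices belonging to block `k`. -/
abbrev BlkIdx (p : ℕ) (r : Fin p → ℕ) (k : ℕ) : Type :=
  {i : BlockIdx p r // (i.1 : ℕ) = k}

/-- One step of Schur complementation: from a matrix on the blocks `k, k+1, …`, written as
`[[J, Bᵀ],[B, N]]` with `J` its block-`(k,k)` part, pass to `N − B J⁻¹ Bᵀ` on the blocks
`k+1, k+2, …`. -/
def schurStep (p : ℕ) (r : Fin p → ℕ) (k : ℕ)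
    (A : Matrix (TailIdx p r k) (TailIdx p r k) ℝ) :
    Matrix (TailIdx p r (k + 1)) (TailIdx p r (k + 1)) ℝ :=
  let e₂ : TailIdx p r (k + 1) → TailIdx p r k := fun i => ⟨i.1, (Nat.le_succ k).trans i.2⟩
  let e₁ : BlkIdx p r k → TailIdx p r k := fun i => ⟨i.1, i.2.ge⟩
  A.submatrix e₂ e₂ - A.submatrix e₂ e₁ * (A.submatrix e₁ e₁)⁻¹ * A.submatrix e₁ e₂

/-- The iterated Schur complements `S⁽ᵏ⁾` of a block matrix: `S⁽⁰⁾ = M` and `S⁽ᵏ⁺¹⁾` is the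
Schur complement of the block-`(k,k)` part of `S⁽ᵏ⁾`. -/
def schurIter (p : ℕ) (r : Fin p → ℕ)
    (M : Matrix (BlockIdx p r) (BlockIdx p r) ℝ) :
    (k : ℕ) → Matrix (TailIdx p r k) (TailIdx p r k) ℝ
  | 0 => M.submatrix (fun i => i.1) (fun i => i.1)
  | k + 1 => schurStep p r k (schurIter p r M k)

/-- `G_k` : the block-`(k,k)` part of the iterated Schur complement `S⁽ᵏ⁾`. -/
def schurBlock (p : ℕ) (r : Fin p → ℕ)
    (M : Matrix (BlockIdx p r) (BlockIdx p r) ℝ) (k : ℕ) :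
    Matrix (BlkIdx p r k) (BlkIdx p r k) ℝ :=
  (schurIter p r M k).submatrix (fun i => ⟨i.1, i.2.ge⟩) (fun i => ⟨i.1, i.2.ge⟩)

/-- `ε_j(τ) = τ₂ τ₃ ⋯ τ_j` (with `ε` of the first block equal to `1`). -/
def epsFactor (p : ℕ) (τ : Fin p → ℝ) (j : Fin p) : ℝ :=
  ∏ k ∈ Finset.univ.filter (fun k : Fin p => 0 < (k : ℕ) ∧ (k : ℕ) ≤ (j : ℕ)), τ k


theorem Matrix.IsHermitian.exists_sum_eigenvalues₀_sq {ι : Type*} [Fintype ι] [DecidableEq ι]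
    {A : Matrix ι ι ℝ} (hA : A.IsHermitian) :
    ∃ u : Fin (Fintype.card ι) → ι → ℝ,
      (∀ x, x ⬝ᵥ x = ∑ k, (u k ⬝ᵥ x) ^ 2) ∧
      ∀ x, x ⬝ᵥ A *ᵥ x = ∑ k, hA.eigenvalues₀ k * (u k ⬝ᵥ x) ^ 2 := by
  let e : Fin (Fintype.card ι) ≃ ι := Fintype.equivOfCardEq (Fintype.card_fin _)
  let v := hA.eigenvectorBasis.reindex e.symm
  have hv : ∀ k, A *ᵥ (v k).ofLp = hA.eigenvalues₀ k • (v k).ofLp := fun k => by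
    have := hA.mulVec_eigenvectorBasis (e k)
    simpa [v, IsHermitian.eigenvalues, e] using this
  have hin : ∀ k x, inner ℝ (v k) (WithLp.toLp 2 x) = (v k).ofLp ⬝ᵥ x := fun k x => by
    simp [EuclideanSpace.inner_eq_star_dotProduct, dotProduct_comm]
  have h2 : ∀ k x, inner ℝ (WithLp.toLp 2 x) (v k) = (v k).ofLp ⬝ᵥ x := fun k x => by
    rw [real_inner_comm, hin]
  refine ⟨fun k => (v k).ofLp, fun x => ?_, fun x => ?_⟩
  · have h := v.sum_inner_mul_inner (WithLp.toLp 2 x) (WithLp.toLp 2 x)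
    simp only [h2, hin] at h
    rw [EuclideanSpace.inner_eq_star_dotProduct] at h
    simpa [sq] using h.symm
  · have h := v.sum_inner_mul_inner (WithLp.toLp 2 x) (WithLp.toLp 2 (A *ᵥ x))
    have h3 : ∀ k, (v k).ofLp ⬝ᵥ A *ᵥ x = hA.eigenvalues₀ k * ((v k).ofLp ⬝ᵥ x) := fun k => by
      have hT : Aᵀ = A := by simpa using hA.eq
      rw [dotProduct_mulVec, ← mulVec_transpose, hT, hv, smul_dotProduct, smul_eq_mul]
    simp only [h2, hin, h3] at h
    rw [EuclideanSpace.inner_eq_star_dotProduct] at h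
    simp only [star_trivial] at h
    rw [dotProduct_comm, ← h]
    exact Finset.sum_congr rfl fun k _ => by ring

/-- Relative monotonicity of ordered eigenvalues under a change of variables. -/
theorem Matrix.PosDef.eigenvalues₀_le_mul {ι : Type*} [Fintype ι] [DecidableEq ι]
    {A B : Matrix ι ι ℝ} (hA : A.PosDef) (hB : B.PosDef) (T : Matrix ι ι ℝ) {c₁ c₂ : ℝ}
    (hc₁ : 0 ≤ c₁)
    (hT : ∀ x, (T *ᵥ x) ⬝ᵥ A *ᵥ (T *ᵥ x) ≤ c₁ * (x ⬝ᵥ B *ᵥ x))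
    (hT' : ∀ x, x ⬝ᵥ x ≤ c₂ * ((T *ᵥ x) ⬝ᵥ (T *ᵥ x))) (k : Fin (Fintype.card ι)) :
    hA.isHermitian.eigenvalues₀ k ≤ c₁ * c₂ * hB.isHermitian.eigenvalues₀ k := by
  obtain ⟨u, hu, huA⟩ := hA.isHermitian.exists_sum_eigenvalues₀_sq
  obtain ⟨v, hv, hvB⟩ := hB.isHermitian.exists_sum_eigenvalues₀_sq
  set a := hA.isHermitian.eigenvalues₀
  set b := hB.isHermitian.eigenvalues₀
  have ha : Antitone a := hA.isHermitian.eigenvalues₀_antitone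
  have hb : Antitone b := hB.isHermitian.eigenvalues₀_antitone
  have hbk : 0 ≤ b k := by
    have := hB.eigenvalues_pos (Fintype.equivOfCardEq (Fintype.card_fin _) k)
    simpa [IsHermitian.eigenvalues] using this.le
  let f : (ι → ℝ) →ₗ[ℝ] ({i : Fin (Fintype.card ι) // i ≠ k} → ℝ) :=
    (Matrix.of fun i : {i : Fin (Fintype.card ι) // i ≠ k} =>
      if i.1 < k then v i.1 else u i.1 ᵥ* T).mulVecLin
  obtain ⟨x, hxf, hx⟩ : ∃ x ∈ LinearMap.ker f, x ≠ 0 := by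
    apply Submodule.exists_mem_ne_zero_of_ne_bot
    apply LinearMap.ker_ne_bot_of_finrank_lt
    have := k.pos
    simp only [Module.finrank_fintype_fun_eq_card, ne_eq, Fintype.card_subtype_compl,
      Fintype.card_fin, Fintype.card_unique]
    omega
  have hf : ∀ i : Fin (Fintype.card ι), i ≠ k →
      (if i < k then v i else u i ᵥ* T) ⬝ᵥ x = 0 := fun i hi => by
    simpa [f, mulVec] using congrFun (LinearMap.mem_ker.1 hxf) ⟨i, hi⟩
  have hxx : 0 < x ⬝ᵥ x := by
    simpa using (Matrix.PosDef.one (n := ι) (R := ℝ)).dotProduct_mulVec_pos hx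
  have h1 : x ⬝ᵥ B *ᵥ x ≤ b k * (x ⬝ᵥ x) := by
    rw [hvB, hv, Finset.mul_sum]
    refine Finset.sum_le_sum fun i _ => ?_
    rcases lt_or_ge i k with h | h
    · have := hf i h.ne
      rw [if_pos h] at this
      simp [this]
    · exact mul_le_mul_of_nonneg_right (hb h) (sq_nonneg _)
  have h2 : a k * ((T *ᵥ x) ⬝ᵥ (T *ᵥ x)) ≤ (T *ᵥ x) ⬝ᵥ A *ᵥ (T *ᵥ x) := by
    rw [huA, hu, Finset.mul_sum]
    refine Finset.sum_le_sum fun i _ => ?_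
    rcases lt_or_ge k i with h | h
    · have := hf i h.ne'
      rw [if_neg h.not_gt, ← dotProduct_mulVec] at this
      simp [this]
    · exact mul_le_mul_of_nonneg_right (ha h) (sq_nonneg _)
  have hy : 0 < (T *ᵥ x) ⬝ᵥ (T *ᵥ x) := by
    have h0 : 0 ≤ (T *ᵥ x) ⬝ᵥ (T *ᵥ x) := by
      simpa using dotProduct_star_self_nonneg (T *ᵥ x)
    refine h0.lt_of_ne fun h => ?_
    have := hT' x
    rw [← h] at this
    linarith
  have h3 := hT x
  have h4 := mul_le_mul_of_nonneg_left h1 hc₁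
  have h5 := mul_le_mul_of_nonneg_left (hT' x) (mul_nonneg hc₁ hbk)
  refine le_of_mul_le_mul_right ?_ hy
  nlinarith

theorem Fintype.exists_equiv_of_map_univ_eq {α β γ : Type*} [Fintype α] [Fintype β]
    {f : α → γ} {g : β → γ} (h : Multiset.map f Finset.univ.val = Multiset.map g Finset.univ.val) :
    ∃ e : α ≃ β, ∀ a, g (e a) = f a := by
  classical
  have hc : ∀ c, Fintype.card {a // f a = c} = Fintype.card {b // g b = c} := fun c => by
    have := congrArg (Multiset.count c) h
    rw [Multiset.count_map, Multiset.count_map] at this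
    simpa [Fintype.card_subtype, Finset.card_def, eq_comm] using this
  let e : α ≃ β := (Equiv.sigmaFiberEquiv f).symm.trans
    ((Equiv.sigmaCongrRight fun c => Fintype.equivOfCardEq (hc c)).trans (Equiv.sigmaFiberEquiv g))
  exact ⟨e, fun a => (Fintype.equivOfCardEq (hc (f a)) ⟨a, rfl⟩).2⟩

open Polynomial in
theorem Matrix.IsHermitian.charpoly_smul_eq {ι : Type*} [Fintype ι] [DecidableEq ι]
    {A : Matrix ι ι ℝ} (hA : A.IsHermitian) (c : ℝ) :
    (c • A).charpoly = ∏ i, (X - C (c * hA.eigenvalues i)) := by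
  conv_lhs => rw [hA.spectral_theorem, Unitary.conjStarAlgAut_apply, ← smul_mul_assoc,
    ← mul_smul_comm, charpoly_mul_comm, ← mul_assoc]
  rw [Unitary.coe_star_mul_self, one_mul, ← diagonal_smul, charpoly_diagonal]
  simp

theorem Matrix.IsHermitian.eigenvalues_le_of_dotProduct_le {ι : Type*} [Fintype ι] [DecidableEq ι]
    {A : Matrix ι ι ℝ} (hA : A.IsHermitian) {c : ℝ}
    (h : ∀ x, x ⬝ᵥ A *ᵥ x ≤ c * (x ⬝ᵥ x)) (i : ι) : hA.eigenvalues i ≤ c := by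
  rw [hA.eigenvalues_eq]
  refine (h _).trans_eq ?_
  have h1 := hA.eigenvectorBasis.orthonormal.1 i
  have : (hA.eigenvectorBasis i).ofLp ⬝ᵥ (hA.eigenvectorBasis i).ofLp = 1 := by
    have h2 := real_inner_self_eq_norm_sq (hA.eigenvectorBasis i)
    rw [h1, EuclideanSpace.inner_eq_star_dotProduct] at h2
    simpa using h2
  rw [star_trivial, this, mul_one]

/-- The eigenvalues of a Hermitian matrix in increasing order. -/
theorem Matrix.IsHermitian.exists_monotone_eigenvalues {ι : Type*} [Fintype ι] [DecidableEq ι]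
    {A : Matrix ι ι ℝ} (hA : A.IsHermitian) {n : ℕ} (hn : Fintype.card ι = n) :
    ∃ e : Fin n ≃ ι, Monotone (hA.eigenvalues ∘ e) := by
  let e := (Fintype.equivFinOfCardEq hn).symm
  exact ⟨(Tuple.sort (hA.eigenvalues ∘ e)).trans e, Tuple.monotone_sort (hA.eigenvalues ∘ e)⟩

theorem Matrix.dotProduct_mulVec_le_of_norm_le {ι : Type*} [Fintype ι] [DecidableEq ι]
    {A : Matrix ι ι ℝ} {c : ℝ} (h : ‖Matrix.toEuclideanCLM (𝕜 := ℝ) A‖ ≤ c) (x : ι → ℝ) :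
    x ⬝ᵥ A *ᵥ x ≤ c * (x ⬝ᵥ x) := by
  have h1 := inner_toEuclideanCLM A (WithLp.toLp 2 x) (WithLp.toLp 2 x)
  have h2 := real_inner_self_eq_norm_sq (WithLp.toLp 2 x)
  rw [EuclideanSpace.inner_eq_star_dotProduct] at h2
  simp only [star_trivial] at h2
  rw [← h1, h2, sq, ← mul_assoc]
  refine (real_inner_le_norm _ _).trans ?_
  rw [mul_comm]
  gcongr
  exact ContinuousLinearMap.le_of_opNorm_le _ h _

theorem Matrix.PosDef.dotProduct_self_le_of_inv_le {ι : Type*} [Fintype ι] [DecidableEq ι]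
    {A : Matrix ι ι ℝ} (hA : A.PosDef) {c : ℝ} (hc : 0 < c)
    (h : ∀ x, x ⬝ᵥ A⁻¹ *ᵥ x ≤ c * (x ⬝ᵥ x)) (x : ι → ℝ) :
    x ⬝ᵥ x ≤ c * (x ⬝ᵥ A *ᵥ x) := by
  have hT : Aᵀ = A := by simpa using hA.isHermitian.eq
  have hAA : A *ᵥ A⁻¹ *ᵥ x = x := by
    rw [mulVec_mulVec, mul_nonsing_inv _ ((isUnit_iff_isUnit_det _).1 hA.isUnit), one_mulVec]
  set w := A⁻¹ *ᵥ x with hw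
  have h1 : 0 ≤ (c • x - w) ⬝ᵥ A *ᵥ (c • x - w) := by
    simpa using hA.posSemidef.dotProduct_mulVec_nonneg (c • x - w)
  have h2 : w ⬝ᵥ A *ᵥ x = x ⬝ᵥ x := by
    rw [dotProduct_mulVec, ← mulVec_transpose, hT, hAA]
  have h3 := h x
  rw [← hw] at h3
  simp only [mulVec_sub, mulVec_smul, hAA, sub_dotProduct, dotProduct_sub, smul_dotProduct,
    dotProduct_smul, smul_eq_mul, h2, dotProduct_comm w x] at h1
  have : 0 ≤ c * (c * (x ⬝ᵥ A *ᵥ x) - x ⬝ᵥ x) := by linarith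
  have := nonneg_of_mul_nonneg_right this hc
  linarith

theorem Matrix.dotProduct_mulVec_self_le_of_abs_le {ι : Type*} [Fintype ι] {A : Matrix ι ι ℝ}
    {a : ℝ} (h : ∀ i j, |A i j| ≤ a) (x : ι → ℝ) :
    (A *ᵥ x) ⬝ᵥ (A *ᵥ x) ≤ (Fintype.card ι) ^ 2 * a ^ 2 * (x ⬝ᵥ x) := by
  have h1 : ∀ i, (A *ᵥ x) i * (A *ᵥ x) i ≤ Fintype.card ι * a ^ 2 * (x ⬝ᵥ x) := fun i => by
    have h2 := Finset.sum_mul_sq_le_sq_mul_sq Finset.univ (A i) x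
    have h3 : ∑ j, A i j ^ 2 ≤ Fintype.card ι * a ^ 2 := by
      refine (Finset.sum_le_card_nsmul _ _ (a ^ 2) fun j _ => ?_).trans_eq (by simp)
      exact sq_le_sq.2 ((h i j).trans (le_abs_self a))
    have h4 : x ⬝ᵥ x = ∑ j, x j ^ 2 := by simp [dotProduct, sq]
    rw [h4, ← sq]
    exact h2.trans (mul_le_mul_of_nonneg_right h3 (Finset.sum_nonneg fun _ _ => sq_nonneg _))
  refine (Finset.sum_le_card_nsmul _ _ _ fun i _ => h1 i).trans_eq ?_
  simp only [Finset.card_univ, nsmul_eq_mul]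
  ring

theorem Matrix.PosDef.add_mulVec_le {ι : Type*} [Fintype ι] [DecidableEq ι]
    {G : Matrix ι ι ℝ} (hG : G.PosDef) {κ η : ℝ} (hκ : 0 ≤ κ) (hη : 0 ≤ η) (hη1 : η ≤ 1)
    (hu : ∀ x, x ⬝ᵥ G *ᵥ x ≤ κ * (x ⬝ᵥ x)) (hl : ∀ x, x ⬝ᵥ x ≤ κ * (x ⬝ᵥ G *ᵥ x))
    {a : ℝ} (ha : 0 ≤ a) (x f : ι → ℝ) (hf : f ⬝ᵥ f ≤ a * η ^ 2 * (x ⬝ᵥ x)) :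
    (x + f) ⬝ᵥ G *ᵥ (x + f) ≤ (1 + (1 + 2 * κ ^ 2 * a) * η) * (x ⬝ᵥ G *ᵥ x) := by
  have hT : Gᵀ = G := by simpa using hG.isHermitian.eq
  have hq : ∀ y, 0 ≤ y ⬝ᵥ G *ᵥ y := fun y => by
    simpa using hG.posSemidef.dotProduct_mulVec_nonneg y
  have hs : f ⬝ᵥ G *ᵥ x = x ⬝ᵥ G *ᵥ f := by
    rw [dotProduct_mulVec, ← mulVec_transpose, hT, dotProduct_comm]
  have hff : f ⬝ᵥ G *ᵥ f ≤ κ ^ 2 * a * η ^ 2 * (x ⬝ᵥ G *ᵥ x) := by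
    calc f ⬝ᵥ G *ᵥ f ≤ κ * (f ⬝ᵥ f) := hu f
      _ ≤ κ * (a * η ^ 2 * (κ * (x ⬝ᵥ G *ᵥ x))) := by
        gcongr
        exact hf.trans (mul_le_mul_of_nonneg_left (hl x) (by positivity))
      _ = _ := by ring
  have hcross : 2 * (x ⬝ᵥ G *ᵥ f) ≤ (η + κ ^ 2 * a * η) * (x ⬝ᵥ G *ᵥ x) := by
    rcases hη.eq_or_lt with rfl | hη0
    · have hf0 : f = 0 := by
        refine dotProduct_self_eq_zero.1 (le_antisymm (by simpa using hf) ?_)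
        simpa using dotProduct_star_self_nonneg f
      simp [hf0]
    · have h := hq (η • x - f)
      simp only [mulVec_sub, mulVec_smul, sub_dotProduct, dotProduct_sub, smul_dotProduct,
        dotProduct_smul, smul_eq_mul, hs] at h
      refine le_of_mul_le_mul_left ?_ hη0
      nlinarith
  have hη2 : κ ^ 2 * a * η ^ 2 * (x ⬝ᵥ G *ᵥ x) ≤ κ ^ 2 * a * η * (x ⬝ᵥ G *ᵥ x) := by
    have : η ^ 2 ≤ η := by nlinarith
    gcongr
    exact hq x
  simp only [mulVec_add, add_dotProduct, dotProduct_add, hs]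
  linarith

/-- `L` is block lower triangular for the grading `b`, with identity diagonal blocks. -/
def Matrix.IsUnitLower {ι : Type*} [DecidableEq ι] (b : ι → ℕ) (L : Matrix ι ι ℝ) : Prop :=
  ∀ i j, b i ≤ b j → L i j = (1 : Matrix ι ι ℝ) i j

theorem Matrix.IsUnitLower.one {ι : Type*} [DecidableEq ι] (b : ι → ℕ) :
    IsUnitLower b (1 : Matrix ι ι ℝ) := fun _ _ _ => rfl

theorem Matrix.IsUnitLower.mul {ι : Type*} [Fintype ι] [DecidableEq ι] {b : ι → ℕ}
    {L K : Matrix ι ι ℝ} (hL : IsUnitLower b L) (hK : IsUnitLower b K) :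
    IsUnitLower b (L * K) := fun i j hij => by
  rw [← one_mul (1 : Matrix ι ι ℝ), mul_apply, mul_apply]
  refine Finset.sum_congr rfl fun l _ => ?_
  rcases le_or_gt (b i) (b l) with h | h
  · rw [hL i l h]
    rcases eq_or_ne i l with rfl | hne
    · rw [hK _ _ hij]
    · simp [one_apply_ne hne]
  · have hlj : l ≠ j := by rintro rfl; omega
    rw [hK l j (by omega), one_apply_ne hlj, mul_zero, mul_zero]

/-- The restriction of a vector to the indices of degree `k`. -/
def gradedPart {ι : Type*} (b : ι → ℕ) (k : ℕ) (x : ι → ℝ) : ι → ℝ :=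
  fun i => if b i = k then x i else 0

theorem Matrix.dotProduct_mulVec_eq_sum_gradedPart {ι : Type*} [Fintype ι] {b : ι → ℕ} {N : ℕ}
    (hN : ∀ i, b i < N) {P : Matrix ι ι ℝ} (hP : ∀ i j, b i ≠ b j → P i j = 0) (x : ι → ℝ) :
    x ⬝ᵥ P *ᵥ x =
      ∑ k ∈ Finset.range N, gradedPart b k x ⬝ᵥ P *ᵥ gradedPart b k x := by
  simp only [dotProduct, mulVec, Finset.mul_sum]
  symm
  rw [Finset.sum_comm]
  refine Finset.sum_congr rfl fun i _ => ?_
  rw [Finset.sum_comm]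
  refine Finset.sum_congr rfl fun j _ => ?_
  rw [Finset.sum_eq_single_of_mem (b i) (Finset.mem_range.2 (hN i))]
  · by_cases h : b i = b j
    · simp [gradedPart, h]
    · simp [hP i j h]
  · intro k _ hk
    simp [gradedPart, hk.symm]

theorem Matrix.IsUnitLower.dotProduct_gradedPart_le {ι : Type*} [Fintype ι] [DecidableEq ι]
    {b : ι → ℕ} {N : ℕ} (hN : ∀ i, b i < N) {L : Matrix ι ι ℝ} (hL : IsUnitLower b L)
    {P : Matrix ι ι ℝ} (hP : ∀ i j, b i ≠ b j → P i j = 0) (hPs : P.PosSemidef) (x : ι → ℝ)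
    {k : ℕ} (hk : k < N) :
    gradedPart b k x ⬝ᵥ P *ᵥ gradedPart b k x ≤
      (Lᵀ *ᵥ gradedPart b k x) ⬝ᵥ P *ᵥ (Lᵀ *ᵥ gradedPart b k x) := by
  have h : gradedPart b k (Lᵀ *ᵥ gradedPart b k x) = gradedPart b k x := by
    ext i
    by_cases hi : b i = k
    · have : ∀ j, Lᵀ i j * gradedPart b k x j = (1 : Matrix ι ι ℝ) i j * gradedPart b k x j := by
        intro j
        by_cases hj : b j = k
        · rw [transpose_apply, hL j i (by omega), one_apply, one_apply]
          simp only [eq_comm]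
        · simp [gradedPart, hj]
      have h2 : (Lᵀ *ᵥ gradedPart b k x) i = ((1 : Matrix ι ι ℝ) *ᵥ gradedPart b k x) i :=
        Finset.sum_congr rfl fun j _ => this j
      rw [one_mulVec] at h2
      rw [← h2]
      simp [gradedPart, hi]
    · simp [gradedPart, hi]
  rw [dotProduct_mulVec_eq_sum_gradedPart hN hP (Lᵀ *ᵥ gradedPart b k x)]
  have h3 := Finset.single_le_sum
    (f := fun m => gradedPart b m (Lᵀ *ᵥ gradedPart b k x) ⬝ᵥ
      P *ᵥ gradedPart b m (Lᵀ *ᵥ gradedPart b k x))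
    (fun m _ => by simpa using hPs.dotProduct_mulVec_nonneg _) (Finset.mem_range.2 hk)
  simpa only [h] using h3

theorem Matrix.dotProduct_mulVec_conj {ι : Type*} [Fintype ι] (L G : Matrix ι ι ℝ) (x : ι → ℝ) :
    x ⬝ᵥ (L * G * Lᵀ) *ᵥ x = (Lᵀ *ᵥ x) ⬝ᵥ G *ᵥ (Lᵀ *ᵥ x) := by
  rw [← mulVec_mulVec, ← mulVec_mulVec, dotProduct_mulVec, ← mulVec_transpose]

/-- Two-sided form bounds pass from a matrix to its block-diagonal factor. -/
theorem Matrix.IsUnitLower.form_bounds {ι : Type*} [Fintype ι] [DecidableEq ι]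
    {b : ι → ℕ} {N : ℕ} (hN : ∀ i, b i < N) {L K M G : Matrix ι ι ℝ} (hL : IsUnitLower b L)
    (hK : IsUnitLower b K) (hM : M = L * G * Lᵀ) (hKM : G = K * M * Kᵀ)
    (hG : ∀ i j, b i ≠ b j → G i j = 0) (hGs : G.PosSemidef) {κ : ℝ}
    (hu : ∀ x, x ⬝ᵥ M *ᵥ x ≤ κ * (x ⬝ᵥ x)) (hl : ∀ x, x ⬝ᵥ x ≤ κ * (x ⬝ᵥ M *ᵥ x)) :
    (∀ x, x ⬝ᵥ G *ᵥ x ≤ κ * (x ⬝ᵥ x)) ∧ (∀ x, x ⬝ᵥ x ≤ κ * (x ⬝ᵥ G *ᵥ x)) := by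
  have h1 : ∀ i j, b i ≠ b j → (1 : Matrix ι ι ℝ) i j = 0 := fun i j h =>
    one_apply_ne (by rintro rfl; exact h rfl)
  have hx : ∀ x : ι → ℝ, x ⬝ᵥ x =
      ∑ k ∈ Finset.range N, gradedPart b k x ⬝ᵥ gradedPart b k x := fun x => by
    simpa using dotProduct_mulVec_eq_sum_gradedPart hN h1 x
  constructor <;> intro x
  · rw [dotProduct_mulVec_eq_sum_gradedPart hN hG, hx, Finset.mul_sum]
    refine Finset.sum_le_sum fun k hk => ?_
    refine (hL.dotProduct_gradedPart_le hN hG hGs x (Finset.mem_range.1 hk)).trans ?_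
    rw [← dotProduct_mulVec_conj, ← hM]
    exact hu _
  · rw [dotProduct_mulVec_eq_sum_gradedPart hN hG, hx, Finset.mul_sum]
    refine Finset.sum_le_sum fun k hk => ?_
    have h2 := hK.dotProduct_gradedPart_le hN h1 PosSemidef.one x (Finset.mem_range.1 hk)
    simp only [one_mulVec] at h2
    refine h2.trans ((hl _).trans_eq ?_)
    rw [← dotProduct_mulVec_conj, ← hKM]

theorem Matrix.abs_apply_le_of_conj_form_le {ι : Type*} [Fintype ι] [DecidableEq ι]
    {L G M : Matrix ι ι ℝ} (hM : M = L * G * Lᵀ) {κ : ℝ} (hκ : 0 ≤ κ)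
    (hu : ∀ x, x ⬝ᵥ M *ᵥ x ≤ κ * (x ⬝ᵥ x)) (hl : ∀ x, x ⬝ᵥ x ≤ κ * (x ⬝ᵥ G *ᵥ x)) (i j : ι) :
    |L i j| ≤ κ := by
  have h1 := hl (Lᵀ *ᵥ Pi.single i 1)
  rw [← dotProduct_mulVec_conj, ← hM] at h1
  have h2 := h1.trans (mul_le_mul_of_nonneg_left (hu (Pi.single i 1)) hκ)
  simp only [mulVec_single_one, dotProduct_single, Pi.single_eq_same, mul_one] at h2
  have h3 := Finset.single_le_sum (f := fun l => Lᵀ.col i l * Lᵀ.col i l)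
    (fun l _ => mul_self_nonneg _) (Finset.mem_univ j)
  have h4 : L i j * L i j ≤ κ * κ := h3.trans h2
  exact abs_le.2 (abs_le_of_sq_le_sq' (by nlinarith) hκ)

theorem Matrix.IsUnitLower.abs_conj_sub_one_le {ι : Type*} [Fintype ι] [DecidableEq ι]
    {b : ι → ℕ} {L : Matrix ι ι ℝ} (hL : IsUnitLower b L) {κ s : ℝ} (hκ : ∀ i j, |L i j| ≤ κ)
    (hs : 0 ≤ s) {w : ι → ℝ} (hw : ∀ i, 0 < w i) (hws : ∀ i j, b j < b i → w i ≤ s * w j)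
    (i j : ι) : |(diagonal w * L * diagonal w⁻¹ - 1 : Matrix ι ι ℝ) i j| ≤ s * κ := by
  have hκ0 : 0 ≤ κ := (abs_nonneg _).trans (hκ i j)
  rw [sub_apply, mul_diagonal, diagonal_mul]
  rcases le_or_gt (b i) (b j) with h | h
  · rw [hL i j h]
    rcases eq_or_ne i j with rfl | hne
    · have := (hw i).ne'
      simp [this]
      positivity
    · simp [one_apply_ne hne]
      positivity
  · rw [one_apply_ne (by rintro rfl; omega), sub_zero, mul_right_comm, abs_mul]
    gcongr
    · rw [Pi.inv_apply, abs_of_nonneg (mul_nonneg (hw i).le (inv_nonneg.2 (hw j).le)),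
        ← div_eq_mul_inv, div_le_iff₀ (hw j)]
      exact hws i j h
    · exact hκ i j

theorem Fintype.sum_dite_subtype {ι : Type*} [Fintype ι] {q : ι → Prop} [DecidablePred q]
    (f : {i // q i} → ℝ) : ∑ i, (if h : q i then f ⟨i, h⟩ else 0) = ∑ i, f i := by
  rw [Finset.sum_dite]
  simp only [Finset.sum_const_zero, add_zero]
  exact Fintype.sum_equiv ((Equiv.refl ι).subtypeEquiv fun i => by simp) _ _ fun i => rfl

/-- One block-elimination step, on the full index set: pivoting on the degree-`k` block. -/
theorem Matrix.exists_block_elimination {ι : Type*} [Fintype ι] [DecidableEq ι] {b : ι → ℕ}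
    {k : ℕ} {A A' : Matrix ι ι ℝ} (hA : A.IsSymm)
    (hJ : IsUnit (A.submatrix (Subtype.val : {i // b i = k} → ι) (Subtype.val : {i // b i = k} → ι)))
    (h0 : ∀ i j, b i < k → k ≤ b j → A i j = 0)
    (hlow : ∀ i j, b i ≤ k → b j ≤ k → A' i j = A i j)
    (hmix : ∀ i j, b i ≤ k → k < b j → A' i j = 0)
    (hmix' : ∀ i j, k < b i → b j ≤ k → A' i j = 0)
    (hhigh : ∀ i j, k < b i → k < b j → A' i j = A i j -
      (A.submatrix id (Subtype.val : {i // b i = k} → ι) *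
        (A.submatrix (Subtype.val : {i // b i = k} → ι) (Subtype.val : {i // b i = k} → ι))⁻¹ *
        A.submatrix (Subtype.val : {i // b i = k} → ι) id : Matrix ι ι ℝ) i j) :
    ∃ X : Matrix ι ι ℝ, (∀ i j, b i ≤ b j → X i j = 0) ∧ X * X = 0 ∧
      A = (1 + X) * A' * (1 + X)ᵀ := by
  let v : {i // b i = k} → ι := Subtype.val
  set J := A.submatrix v v with hJdef
  set B := A.submatrix id v with hBdef
  have hBt : A.submatrix v id = Bᵀ := by
    rw [hBdef, transpose_submatrix, hA.eq]
  have hJs : J.IsSymm := hA.submatrix v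
  have hJis : (J⁻¹)ᵀ = J⁻¹ := by rw [transpose_nonsing_inv, hJs.eq]
  have hdet : IsUnit J.det := (isUnit_iff_isUnit_det _).1 hJ
  let X : Matrix ι ι ℝ := of fun i j =>
    if k < b i then if h : b j = k then (B * J⁻¹) i ⟨j, h⟩ else 0 else 0
  have hX0 : ∀ i j, b i ≤ k → X i j = 0 := fun i j h => by simp [X, h.not_gt]
  have hX1 : ∀ i j, b j ≠ k → X i j = 0 := fun i j h => by simp [X, h]
  have hXs : ∀ i, k < b i → ∀ u : ι → ℝ,
      ∑ l, X i l * u l = ∑ l : {i // b i = k}, (B * J⁻¹) i l * u l := fun i hi u => by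
    rw [← Fintype.sum_dite_subtype]
    refine Finset.sum_congr rfl fun l _ => ?_
    by_cases h : b l = k <;> simp [X, hi, h]
  have hA's : A'.IsSymm := by
    refine IsSymm.ext fun i j => ?_
    rcases le_or_gt (b i) k with hi | hi <;> rcases le_or_gt (b j) k with hj | hj
    · rw [hlow _ _ hi hj, hlow _ _ hj hi, hA.apply]
    · rw [hmix _ _ hi hj, hmix' _ _ hj hi]
    · rw [hmix _ _ hj hi, hmix' _ _ hi hj]
    · rw [hhigh _ _ hi hj, hhigh _ _ hj hi, hA.apply, hBt]
      congr 1
      rw [← transpose_apply (B * J⁻¹ * Bᵀ)]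
      simp only [transpose_mul, transpose_transpose, hJis, Matrix.mul_assoc]
  have hY : ∀ i j, (X * A') i j = if k < b i ∧ b j = k then A i j else 0 := fun i j => by
    rw [mul_apply]
    by_cases hi : k < b i
    · rw [hXs i hi]
      by_cases hj : b j = k
      · rw [if_pos ⟨hi, hj⟩]
        have : ∀ l : {i // b i = k}, A' l j = J l ⟨j, hj⟩ := fun l =>
          hlow _ _ l.2.le hj.le
        simp only [this]
        rw [← mul_apply, Matrix.mul_assoc, nonsing_inv_mul _ hdet, Matrix.mul_one]
        rfl
      · rw [if_neg (fun h => hj h.2)]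
        refine Finset.sum_eq_zero fun l _ => ?_
        rcases lt_or_ge k (b j) with h | h
        · rw [hmix _ _ l.2.le h, mul_zero]
        · rw [hlow _ _ l.2.le h, ← hA.apply, h0 _ _ (by omega) l.2.ge, mul_zero]
    · rw [if_neg (fun h => hi h.1)]
      exact Finset.sum_eq_zero fun l _ => by rw [hX0 i l (by omega), zero_mul]
  have hW : ∀ i j, (X * A' * Xᵀ) i j =
      if k < b i ∧ k < b j then (B * J⁻¹ * Bᵀ) j i else 0 := fun i j => by
    rw [mul_apply]
    simp only [transpose_apply, hY, mul_comm _ (X j _)]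
    by_cases hj : k < b j
    · rw [hXs j hj]
      by_cases hi : k < b i
      · rw [if_pos ⟨hi, hj⟩, mul_apply]
        refine Finset.sum_congr rfl fun l _ => ?_
        rw [if_pos ⟨hi, l.2⟩]
        rfl
      · simp [hi]
    · rw [if_neg (fun h => hj h.2)]
      exact Finset.sum_eq_zero fun l _ => by rw [hX0 j l (by omega), zero_mul]
  refine ⟨X, fun i j hij => ?_, ?_, ?_⟩
  · by_cases hi : b i ≤ k
    · exact hX0 i j hi
    · exact hX1 i j (by omega)
  · ext i j
    rw [mul_apply, zero_apply]
    refine Finset.sum_eq_zero fun l _ => ?_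
    by_cases hl : b l = k
    · rw [hX0 l j hl.le, mul_zero]
    · rw [hX1 i l hl, zero_mul]
  · have hexp : (1 + X) * A' * (1 + X)ᵀ = A' + X * A' + (X * A')ᵀ + X * A' * Xᵀ := by
      rw [transpose_add, transpose_one, transpose_mul, hA's.eq]
      noncomm_ring
    rw [hexp]
    ext i j
    simp only [add_apply, hW, transpose_apply, hY]
    rcases lt_trichotomy (b i) k with hi | hi | hi <;>
      rcases lt_trichotomy (b j) k with hj | hj | hj
    · rw [hlow _ _ hi.le hj.le]; simp [hi.not_gt, hj.not_gt]
    · rw [hlow _ _ hi.le hj.le]; simp [hi.not_gt, hj]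
    · rw [hmix _ _ hi.le hj, h0 _ _ hi hj.le]; simp [hi.not_gt, hi.ne]
    · rw [hlow _ _ hi.le hj.le]; simp [hi, hj.not_gt]
    · rw [hlow _ _ hi.le hj.le]; simp [hi, hj]
    · rw [hmix _ _ hi.le hj]; simp [hi, hj, hA.apply]
    · rw [hmix' _ _ hi hj.le, ← hA.apply, h0 _ _ hj hi.le]; simp [hj.not_gt, hj.ne]
    · rw [hmix' _ _ hi hj.le]; simp [hi, hj]
    · rw [hhigh _ _ hi hj, hBt, ← transpose_apply (B * J⁻¹ * Bᵀ) j i]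
      simp only [transpose_mul, transpose_transpose, hJis, Matrix.mul_assoc]
      simp [hi, hj, hi.ne', hj.ne']

theorem Matrix.dotProduct_mulVec_le_transpose {ι : Type*} [Fintype ι] [DecidableEq ι]
    {K L : Matrix ι ι ℝ} (hKL : K * L = 1) {e c : ℝ} (he : ∀ i j, |(K - 1) i j| ≤ e)
    (hc : ∀ i j, |L i j| ≤ c) (u : ι → ℝ) :
    (K *ᵥ u) ⬝ᵥ (K *ᵥ u) ≤
      (1 + (Fintype.card ι) ^ 4 * c ^ 2 * e ^ 2) * ((Kᵀ *ᵥ u) ⬝ᵥ (Kᵀ *ᵥ u)) := by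
  set E := K - 1 with hE
  have hK : K = 1 + E := by rw [hE]; abel
  have h1 : (K *ᵥ u) ⬝ᵥ (K *ᵥ u) = u ⬝ᵥ u + 2 * (u ⬝ᵥ E *ᵥ u) + (E *ᵥ u) ⬝ᵥ (E *ᵥ u) := by
    rw [hK, add_mulVec, one_mulVec, add_dotProduct, dotProduct_add, dotProduct_add,
      dotProduct_comm (E *ᵥ u) u]
    ring
  have h2 : (Kᵀ *ᵥ u) ⬝ᵥ (Kᵀ *ᵥ u) =
      u ⬝ᵥ u + 2 * (u ⬝ᵥ E *ᵥ u) + (Eᵀ *ᵥ u) ⬝ᵥ (Eᵀ *ᵥ u) := by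
    have : u ⬝ᵥ E *ᵥ u = u ⬝ᵥ Eᵀ *ᵥ u := by
      rw [dotProduct_mulVec, ← mulVec_transpose, dotProduct_comm]
    rw [this, hK, transpose_add, transpose_one, add_mulVec, one_mulVec, add_dotProduct,
      dotProduct_add, dotProduct_add, dotProduct_comm (Eᵀ *ᵥ u) u]
    ring
  have h3 : 0 ≤ (Eᵀ *ᵥ u) ⬝ᵥ (Eᵀ *ᵥ u) := by
    simpa using dotProduct_star_self_nonneg (Eᵀ *ᵥ u)
  have h4 := dotProduct_mulVec_self_le_of_abs_le he u
  have h5 := dotProduct_mulVec_self_le_of_abs_le (A := Lᵀ) (fun i j => hc j i) (Kᵀ *ᵥ u)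
  rw [mulVec_mulVec, ← transpose_mul, hKL, transpose_one, one_mulVec] at h5
  have h6 := mul_le_mul_of_nonneg_left h5
    (show 0 ≤ (Fintype.card ι : ℝ) ^ 2 * e ^ 2 by positivity)
  linarith

theorem Matrix.diagonal_inv_mul_diagonal {ι : Type*} [Fintype ι] [DecidableEq ι] {w : ι → ℝ}
    (hw : ∀ i, 0 < w i) : diagonal w⁻¹ * diagonal w = (1 : Matrix ι ι ℝ) := by
  rw [diagonal_mul_diagonal, ← diagonal_one]
  congr 1
  ext i
  exact inv_mul_cancel₀ (hw i).ne'

theorem Matrix.diagonal_conj_mul {ι : Type*} [Fintype ι] [DecidableEq ι] {w : ι → ℝ}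
    (hw : ∀ i, 0 < w i) (A B : Matrix ι ι ℝ) :
    (diagonal w * A * diagonal w⁻¹) * (diagonal w * B * diagonal w⁻¹) =
      diagonal w * (A * B) * diagonal w⁻¹ := by
  calc _ = diagonal w * A * (diagonal w⁻¹ * diagonal w) * B * diagonal w⁻¹ := by
        simp only [Matrix.mul_assoc]
    _ = _ := by rw [diagonal_inv_mul_diagonal hw]; simp only [Matrix.mul_assoc, Matrix.mul_one]

theorem Matrix.diagonal_mul_diagonal_inv {ι : Type*} [Fintype ι] [DecidableEq ι] {w : ι → ℝ}
    (hw : ∀ i, 0 < w i) : diagonal w * diagonal w⁻¹ = (1 : Matrix ι ι ℝ) := by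
  rw [diagonal_mul_diagonal, ← diagonal_one]
  congr 1
  ext i
  exact mul_inv_cancel₀ (hw i).ne'

theorem Matrix.IsUnitLower.graded_form_le {ι : Type*} [Fintype ι] [DecidableEq ι] {b : ι → ℕ}
    {L G : Matrix ι ι ℝ} (hL : IsUnitLower b L) (hG : G.PosDef) {κ t : ℝ} (hκ : 0 ≤ κ)
    (hLκ : ∀ i j, |L i j| ≤ κ) (ht : 0 ≤ t) (ht1 : t ≤ 1)
    (hu : ∀ x, x ⬝ᵥ G *ᵥ x ≤ κ * (x ⬝ᵥ x)) (hl : ∀ x, x ⬝ᵥ x ≤ κ * (x ⬝ᵥ G *ᵥ x))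
    {w : ι → ℝ} (hw : ∀ i, 0 < w i) (hwt : ∀ i j, b j < b i → w i ≤ t * w j) (x : ι → ℝ) :
    ((diagonal w * L * diagonal w⁻¹) *ᵥ x) ⬝ᵥ (diagonal w * G * diagonal w) *ᵥ
        ((diagonal w * L * diagonal w⁻¹) *ᵥ x) ≤
      (1 + (1 + 2 * κ ^ 4 * (Fintype.card ι) ^ 2) * t ^ 2) *
        (x ⬝ᵥ (diagonal w * G * diagonal w) *ᵥ x) := by
  have hD : ∀ y, y ⬝ᵥ (diagonal w * G * diagonal w) *ᵥ y =
      (diagonal w *ᵥ y) ⬝ᵥ G *ᵥ (diagonal w *ᵥ y) := fun y => by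
    simpa using dotProduct_mulVec_conj (diagonal w) G y
  set F := diagonal (w ^ 2) * L * diagonal (w ^ 2)⁻¹ - 1 with hF
  have hFb : ∀ i j, |F i j| ≤ t ^ 2 * κ := hL.abs_conj_sub_one_le hLκ (sq_nonneg t)
    (fun i => pow_pos (hw i) 2) (fun i j hij => by
      rw [Pi.pow_apply, Pi.pow_apply, ← mul_pow]
      exact pow_le_pow_left₀ (hw i).le (hwt i j hij) 2)
  have hFx : diagonal w *ᵥ ((diagonal w * L * diagonal w⁻¹) *ᵥ x) =
      diagonal w *ᵥ x + F *ᵥ (diagonal w *ᵥ x) := by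
    have : diagonal w * (diagonal w * L * diagonal w⁻¹) = (1 + F) * diagonal w := by
      have h2 : diagonal (w ^ 2)⁻¹ * diagonal w = (diagonal w⁻¹ : Matrix ι ι ℝ) := by
        rw [diagonal_mul_diagonal]
        congr 1
        ext i
        have := (hw i).ne'
        simp only [Pi.inv_apply, Pi.pow_apply]
        field_simp
      have h3 : (diagonal (w ^ 2) : Matrix ι ι ℝ) = diagonal w * diagonal w := by
        rw [diagonal_mul_diagonal]
        congr 1
        ext i
        simp [sq]
      rw [hF, add_sub_cancel, Matrix.mul_assoc _ _ (diagonal w), h2, h3]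
      simp only [Matrix.mul_assoc]
    rw [mulVec_mulVec, this, ← mulVec_mulVec, add_mulVec, one_mulVec]
  rw [hD, hD, hFx]
  have h := hG.add_mulVec_le hκ (sq_nonneg t) (pow_le_one₀ ht ht1) hu hl
    (a := (Fintype.card ι) ^ 2 * κ ^ 2) (by positivity) (diagonal w *ᵥ x)
    (F *ᵥ (diagonal w *ᵥ x))
    ((dotProduct_mulVec_self_le_of_abs_le hFb _).trans_eq (by ring))
  refine h.trans_eq ?_
  ring

theorem Matrix.PosDef.mul_mul_transpose_of_mul_eq_one {ι : Type*} [Fintype ι] [DecidableEq ι]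
    {A K L : Matrix ι ι ℝ} (hA : A.PosDef) (hKL : K * L = 1) : (K * A * Kᵀ).PosDef := by
  have := hA.mul_mul_conjTranspose_same (B := K) fun x y hxy => by
    have := congrArg (fun z => z ᵥ* L) hxy
    simpa [vecMul_vecMul, hKL] using this
  simpa using this

theorem Matrix.PosDef.diagonal_mul_mul_diagonal {ι : Type*} [Fintype ι] [DecidableEq ι]
    {A : Matrix ι ι ℝ} (hA : A.PosDef) {w : ι → ℝ} (hw : ∀ i, 0 < w i) :
    (diagonal w * A * diagonal w).PosDef := by
  simpa using hA.mul_mul_transpose_of_mul_eq_one (diagonal_mul_diagonal_inv hw)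

/-- Ordered eigenvalues of a graded matrix `ΩMΩ` and of its block-diagonal model `ΩGΩ`, where
`M = L G Lᵀ`, agree up to a relative error quadratic in the grading ratio `t`. -/
theorem Matrix.IsUnitLower.graded_eigenvalues₀_le {ι : Type*} [Fintype ι] [DecidableEq ι]
    {b : ι → ℕ} {L K M G : Matrix ι ι ℝ} (hL : IsUnitLower b L) (hK : IsUnitLower b K)
    (hLK : L * K = 1) (hKL : K * L = 1) (hMG : M = L * G * Lᵀ)
    (hG : G.PosDef) {κ t : ℝ} (hκ : 0 ≤ κ)
    (hLκ : ∀ i j, |L i j| ≤ κ) (hKκ : ∀ i j, |K i j| ≤ κ) (ht : 0 ≤ t) (ht1 : t ≤ 1)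
    (hu : ∀ x, x ⬝ᵥ G *ᵥ x ≤ κ * (x ⬝ᵥ x)) (hl : ∀ x, x ⬝ᵥ x ≤ κ * (x ⬝ᵥ G *ᵥ x))
    {w : ι → ℝ} (hw : ∀ i, 0 < w i) (hwt : ∀ i j, b j < b i → w i ≤ t * w j)
    (hMw : (diagonal w * M * diagonal w).PosDef) (hGw : (diagonal w * G * diagonal w).PosDef)
    (k : Fin (Fintype.card ι)) :
    hMw.isHermitian.eigenvalues₀ k ≤
      (1 + (1 + 2 * κ ^ 4 * (Fintype.card ι) ^ 2) * t ^ 2) *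
        (1 + (Fintype.card ι) ^ 4 * (κ + 1) ^ 2 * κ ^ 2 * t ^ 2) *
        hGw.isHermitian.eigenvalues₀ k ∧
    hGw.isHermitian.eigenvalues₀ k ≤
      (1 + (1 + 2 * κ ^ 4 * (Fintype.card ι) ^ 2) * t ^ 2) *
        (1 + (Fintype.card ι) ^ 4 * (κ + 1) ^ 2 * κ ^ 2 * t ^ 2) *
        hMw.isHermitian.eigenvalues₀ k := by
  have hLf := hL.graded_form_le hG hκ hLκ ht ht1 hu hl hw hwt
  have hKf := hK.graded_form_le hG hκ hKκ ht ht1 hu hl hw hwt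
  have hLb : ∀ i j, |(diagonal w * L * diagonal w⁻¹ : Matrix ι ι ℝ) i j| ≤ κ + 1 := fun i j => by
    have h1 := hL.abs_conj_sub_one_le hLκ ht hw hwt i j
    have h2 : |(1 : Matrix ι ι ℝ) i j| ≤ 1 := by
      rw [one_apply]; split_ifs <;> simp
    have h3 := abs_add_le ((diagonal w * L * diagonal w⁻¹ - 1 : Matrix ι ι ℝ) i j)
      ((1 : Matrix ι ι ℝ) i j)
    rw [sub_apply, sub_add_cancel] at h3
    rw [sub_apply] at h1
    nlinarith
  have hKb := hK.abs_conj_sub_one_le hKκ ht hw hwt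
  have hone : diagonal w * (1 : Matrix ι ι ℝ) * diagonal w⁻¹ = 1 := by
    rw [Matrix.mul_one, diagonal_mul_diagonal_inv hw]
  have hLK' := diagonal_conj_mul hw L K
  have hKL' := diagonal_conj_mul hw K L
  rw [hLK, hone] at hLK'
  rw [hKL, hone] at hKL'
  have hMD : diagonal w * M * diagonal w = (diagonal w * L * diagonal w⁻¹) *
      (diagonal w * G * diagonal w) * (diagonal w * L * diagonal w⁻¹)ᵀ := by
    have h1 : (diagonal w * L * diagonal w⁻¹)ᵀ = diagonal w⁻¹ * Lᵀ * diagonal w := by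
      simp only [transpose_mul, diagonal_transpose, Matrix.mul_assoc]
    rw [h1, hMG]
    calc _ = diagonal w * L * 1 * G * 1 * Lᵀ * diagonal w := by
          simp only [Matrix.mul_assoc, Matrix.mul_one]
      _ = diagonal w * L * (diagonal w⁻¹ * diagonal w) * G * (diagonal w * diagonal w⁻¹) * Lᵀ *
          diagonal w := by
          rw [diagonal_inv_mul_diagonal hw, diagonal_mul_diagonal_inv hw]
      _ = _ := by simp only [Matrix.mul_assoc]
  set Lw := diagonal w * L * diagonal w⁻¹
  set Kw := diagonal w * K * diagonal w⁻¹
  have hMx : ∀ x, x ⬝ᵥ (diagonal w * M * diagonal w) *ᵥ x =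
      (Lwᵀ *ᵥ x) ⬝ᵥ (diagonal w * G * diagonal w) *ᵥ (Lwᵀ *ᵥ x) := fun x => by
    rw [hMD, dotProduct_mulVec_conj]
  have hc₁ : 0 ≤ 1 + (1 + 2 * κ ^ 4 * (Fintype.card ι : ℝ) ^ 2) * t ^ 2 := by positivity
  have hLKt : Lwᵀ * Kwᵀ = 1 := by rw [← transpose_mul, hKL', transpose_one]
  have hKLt : Kwᵀ * Lwᵀ = 1 := by rw [← transpose_mul, hLK', transpose_one]
  have hKbt : ∀ i j, |(Kwᵀ - 1) i j| ≤ t * κ := fun i j => by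
    have := hKb j i
    rwa [← transpose_apply (Kw - 1), transpose_sub, transpose_one] at this
  constructor
  · refine hMw.eigenvalues₀_le_mul hGw (Kwᵀ * Lw) hc₁ (fun x => ?_) (fun x => ?_) k
    · rw [hMx, mulVec_mulVec, ← Matrix.mul_assoc, hLKt, Matrix.one_mul]
      exact hLf x
    · have := dotProduct_mulVec_le_transpose hKL' hKb hLb (Lw *ᵥ x)
      rw [mulVec_mulVec, mulVec_mulVec, hKL', one_mulVec] at this
      exact this.trans_eq (by ring)
  · refine hGw.eigenvalues₀_le_mul hMw (Kw * Lwᵀ) hc₁ (fun x => ?_) (fun x => ?_) k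
    · rw [hMx, ← mulVec_mulVec]
      exact hKf _
    · have := dotProduct_mulVec_le_transpose hKLt hKbt (fun i j => hLb j i) (Lwᵀ *ᵥ x)
      rw [transpose_transpose, mulVec_mulVec, mulVec_mulVec, hKLt, one_mulVec] at this
      exact this.trans_eq (by ring)

theorem epsFactor_pos {p : ℕ} {τ : Fin p → ℝ} (hτ : ∀ k : Fin p, 0 < (k : ℕ) → 0 < τ k)
    (j : Fin p) : 0 < epsFactor p τ j :=
  Finset.prod_pos fun k hk => hτ k (Finset.mem_filter.1 hk).2.1

theorem epsFactor_le_mul {p : ℕ} {τ : Fin p → ℝ} {t : ℝ}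
    (hτ : ∀ k : Fin p, 0 < (k : ℕ) → 0 < τ k) (hτt : ∀ k : Fin p, 0 < (k : ℕ) → τ k ≤ t)
    (ht1 : t ≤ 1) {i j : Fin p} (hij : (j : ℕ) < i) :
    epsFactor p τ i ≤ t * epsFactor p τ j := by
  have hsub : Finset.univ.filter (fun k : Fin p => 0 < (k : ℕ) ∧ (k : ℕ) ≤ (j : ℕ)) ⊆
      Finset.univ.filter (fun k : Fin p => 0 < (k : ℕ) ∧ (k : ℕ) ≤ (i : ℕ)) := by
    intro k hk
    simp only [Finset.mem_filter, Finset.mem_univ, true_and] at hk ⊢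
    omega
  have hpos := epsFactor_pos hτ j
  unfold epsFactor at hpos ⊢
  rw [← Finset.prod_sdiff hsub]
  gcongr
  have hmem : i ∈ Finset.univ.filter (fun k : Fin p => 0 < (k : ℕ) ∧ (k : ℕ) ≤ (i : ℕ)) \
      Finset.univ.filter (fun k : Fin p => 0 < (k : ℕ) ∧ (k : ℕ) ≤ (j : ℕ)) := by
    simp only [Finset.mem_sdiff, Finset.mem_filter, Finset.mem_univ, true_and]
    omega
  have hi : 0 < (i : ℕ) := by omega
  rw [← Finset.mul_prod_erase _ _ hmem]
  have h1 : ∏ k ∈ (Finset.univ.filter (fun k : Fin p => 0 < (k : ℕ) ∧ (k : ℕ) ≤ (i : ℕ)) \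
      Finset.univ.filter (fun k : Fin p => 0 < (k : ℕ) ∧ (k : ℕ) ≤ (j : ℕ))).erase i, τ k ≤ 1 := by
    have hk : ∀ k ∈ (Finset.univ.filter (fun k : Fin p => 0 < (k : ℕ) ∧ (k : ℕ) ≤ (i : ℕ)) \
      Finset.univ.filter (fun k : Fin p => 0 < (k : ℕ) ∧ (k : ℕ) ≤ (j : ℕ))).erase i,
        0 < (k : ℕ) := fun k hk => by
      simp only [Finset.mem_erase, Finset.mem_sdiff, Finset.mem_filter] at hk
      exact hk.2.1.2.1
    exact Finset.prod_le_one (fun k h => (hτ k (hk k h)).le)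
      (fun k h => (hτt k (hk k h)).trans ht1)
  exact (mul_le_of_le_one_right (hτ i hi).le h1).trans (hτt i hi)

/-- The matrix obtained after eliminating the first `k` blocks: block diagonal with blocks
`G_0, …, G_{k-1}` followed by the iterated Schur complement `S⁽ᵏ⁾`. -/
def partialSchur (p : ℕ) (r : Fin p → ℕ) (M : Matrix (BlockIdx p r) (BlockIdx p r) ℝ) (k : ℕ) :
    Matrix (BlockIdx p r) (BlockIdx p r) ℝ :=
  of fun i j =>
    if h : k ≤ (i.1 : ℕ) ∧ k ≤ (j.1 : ℕ) then schurIter p r M k ⟨i, h.1⟩ ⟨j, h.2⟩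
    else if h : (i.1 : ℕ) = j.1 then schurBlock p r M i.1 ⟨i, rfl⟩ ⟨j, h.symm⟩
    else 0

section PartialSchur

variable {p : ℕ} {r : Fin p → ℕ} (M : Matrix (BlockIdx p r) (BlockIdx p r) ℝ)

theorem partialSchur_zero : partialSchur p r M 0 = M := by
  ext i j
  simp [partialSchur, schurIter]

theorem partialSchur_apply_of_le {k : ℕ} {i j : BlockIdx p r} (hi : k ≤ (i.1 : ℕ))
    (hj : k ≤ (j.1 : ℕ)) : partialSchur p r M k i j = schurIter p r M k ⟨i, hi⟩ ⟨j, hj⟩ := by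
  simp only [partialSchur, of_apply]
  rw [dif_pos ⟨hi, hj⟩]

theorem partialSchur_apply_of_eq {k : ℕ} {i j : BlockIdx p r} (hi : (i.1 : ℕ) ≤ k)
    (hij : (j.1 : ℕ) = i.1) :
    partialSchur p r M k i j = schurBlock p r M i.1 ⟨i, rfl⟩ ⟨j, hij⟩ := by
  rcases hi.eq_or_lt with h | h
  · subst h
    rw [partialSchur_apply_of_le M le_rfl hij.ge]
    rfl
  · simp only [partialSchur, of_apply]
    rw [dif_neg (by omega), dif_pos hij.symm]

theorem partialSchur_apply_of_ne {k : ℕ} {i j : BlockIdx p r}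
    (h : ¬ (k ≤ (i.1 : ℕ) ∧ k ≤ (j.1 : ℕ))) (hij : (i.1 : ℕ) ≠ j.1) :
    partialSchur p r M k i j = 0 := by
  simp only [partialSchur, of_apply]
  rw [dif_neg h, dif_neg hij]

theorem partialSchur_succ_apply_of_lt {k : ℕ} {i j : BlockIdx p r} (hi : k < (i.1 : ℕ))
    (hj : k < (j.1 : ℕ)) :
    partialSchur p r M (k + 1) i j = partialSchur p r M k i j -
      ((partialSchur p r M k).submatrix id (Subtype.val : BlkIdx p r k → BlockIdx p r) *
        ((partialSchur p r M k).submatrix (Subtype.val : BlkIdx p r k → BlockIdx p r)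
          (Subtype.val : BlkIdx p r k → BlockIdx p r))⁻¹ *
        (partialSchur p r M k).submatrix (Subtype.val : BlkIdx p r k → BlockIdx p r) id :
          Matrix (BlockIdx p r) (BlockIdx p r) ℝ) i j := by
  rw [partialSchur_apply_of_le M hi hj, partialSchur_apply_of_le M hi.le hj.le]
  have hJ : (partialSchur p r M k).submatrix (Subtype.val : BlkIdx p r k → BlockIdx p r)
      (Subtype.val : BlkIdx p r k → BlockIdx p r) =
      (schurIter p r M k).submatrix (fun i : BlkIdx p r k => ⟨i.1, i.2.ge⟩)
        (fun i => ⟨i.1, i.2.ge⟩) := by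
    ext l m
    exact partialSchur_apply_of_le M l.2.ge m.2.ge
  rw [hJ]
  simp only [schurIter, schurStep, Matrix.sub_apply, submatrix_apply, mul_apply, id_eq]
  congr 1
  refine Finset.sum_congr rfl fun l _ => ?_
  rw [partialSchur_apply_of_le M l.2.ge hj.le]
  congr 1
  refine Finset.sum_congr rfl fun m _ => ?_
  rw [partialSchur_apply_of_le M hi.le m.2.ge]

theorem exists_partialSchur_factorization (hM : M.PosDef) (k : ℕ) :
    ∃ L K : Matrix (BlockIdx p r) (BlockIdx p r) ℝ,
      IsUnitLower (fun i => (i.1 : ℕ)) L ∧ IsUnitLower (fun i => (i.1 : ℕ)) K ∧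
      L * K = 1 ∧ K * L = 1 ∧ M = L * partialSchur p r M k * Lᵀ ∧
      partialSchur p r M k = K * M * Kᵀ := by
  induction k with
  | zero =>
    exact ⟨1, 1, .one _, .one _, by simp, by simp, by simp [partialSchur_zero],
      by simp [partialSchur_zero]⟩
  | succ k ih =>
    obtain ⟨L, K, hL, hK, hLK, hKL, hML, hMK⟩ := ih
    have hpd : (partialSchur p r M k).PosDef := by
      rw [hMK]
      exact hM.mul_mul_transpose_of_mul_eq_one hKL
    obtain ⟨X, hX, hXX, hstep⟩ := exists_block_elimination (b := fun i : BlockIdx p r => (i.1 : ℕ))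
      (k := k) (A := partialSchur p r M k) (A' := partialSchur p r M (k + 1))
      (show (partialSchur p r M k)ᵀ = _ by simpa using hpd.isHermitian.eq)
      (hpd.submatrix Subtype.val_injective).isUnit
      (fun i j hi hj => partialSchur_apply_of_ne M (by omega) (by omega))
      (fun i j hi hj => by
        by_cases hij : (j.1 : ℕ) = i.1
        · rw [partialSchur_apply_of_eq M (hi.trans (Nat.le_succ k)) hij,
            partialSchur_apply_of_eq M hi hij]
        · rw [partialSchur_apply_of_ne M (by omega) (Ne.symm hij),
            partialSchur_apply_of_ne M (by omega) (Ne.symm hij)])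
      (fun i j hi hj => partialSchur_apply_of_ne M (by omega) (by omega))
      (fun i j hi hj => partialSchur_apply_of_ne M (by omega) (by omega))
      (fun i j hi hj => partialSchur_succ_apply_of_lt M hi hj)
    have h1 : (1 + X) * (1 - X) = 1 := by
      have : (1 + X) * (1 - X) = 1 - X * X := by noncomm_ring
      rw [this, hXX, sub_zero]
    have h2 : (1 - X) * (1 + X) = 1 := by
      have : (1 - X) * (1 + X) = 1 - X * X := by noncomm_ring
      rw [this, hXX, sub_zero]
    refine ⟨L * (1 + X), (1 - X) * K, hL.mul fun i j hij => ?_,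
      IsUnitLower.mul (fun i j hij => ?_) hK, ?_, ?_, ?_, ?_⟩
    · rw [Matrix.add_apply, hX i j hij, add_zero]
    · rw [Matrix.sub_apply, hX i j hij, sub_zero]
    · rw [Matrix.mul_assoc, ← Matrix.mul_assoc _ _ K, h1, Matrix.one_mul, hLK]
    · rw [Matrix.mul_assoc, ← Matrix.mul_assoc _ _ (1 + X), hKL, Matrix.one_mul, h2]
    · conv_lhs => rw [hML, hstep]
      simp only [transpose_mul, Matrix.mul_assoc]
    · have h3 : partialSchur p r M (k + 1) =
          (1 - X) * partialSchur p r M k * (1 - X)ᵀ := by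
        have h4 : (1 + X)ᵀ * (1 - X)ᵀ = 1 := by rw [← transpose_mul, h2, transpose_one]
        rw [hstep, Matrix.mul_assoc (1 + X), ← Matrix.mul_assoc (1 - X), h2, Matrix.one_mul,
          Matrix.mul_assoc _ (1 + X)ᵀ, h4, Matrix.mul_one]
      rw [h3, hMK]
      simp only [transpose_mul, Matrix.mul_assoc]

theorem partialSchur_last_apply_of_ne {i j : BlockIdx p r} (hij : (i.1 : ℕ) ≠ j.1) :
    partialSchur p r M p i j = 0 :=
  partialSchur_apply_of_ne M (fun h => by have := i.1.2; omega) hij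

theorem schurBlock_eq_submatrix_partialSchur (j : Fin p) :
    schurBlock p r M j = (partialSchur p r M p).submatrix
      (Subtype.val : BlkIdx p r j → BlockIdx p r) Subtype.val := by
  ext ⟨x, hx⟩ ⟨y, hy⟩
  obtain rfl : x.1 = j := Fin.ext hx
  exact (partialSchur_apply_of_eq M x.1.2.le hy).symm

end PartialSchur

theorem card_blkIdx (p : ℕ) (r : Fin p → ℕ) (j : Fin p) :
    Fintype.card (BlkIdx p r j) = r j := by
  rw [← Fintype.card_fin (r j)]
  exact Fintype.card_congr
    { toFun := fun x => Fin.cast (congrArg r (Fin.ext x.2)) x.1.2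
      invFun := fun m => ⟨⟨j, m⟩, rfl⟩
      left_inv := by
        rintro ⟨⟨i, m⟩, hx⟩
        obtain rfl : i = j := Fin.ext hx
        rfl
      right_inv := fun m => rfl }

theorem Matrix.submatrix_form_le {ι κ : Type*} [Fintype ι] [Fintype κ]
    {A : Matrix ι ι ℝ} {c : ℝ} (h : ∀ x, x ⬝ᵥ A *ᵥ x ≤ c * (x ⬝ᵥ x)) {f : κ → ι}
    (hf : Function.Injective f) (y : κ → ℝ) :
    y ⬝ᵥ A.submatrix f f *ᵥ y ≤ c * (y ⬝ᵥ y) := by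
  classical
  have hsum : ∀ g : ι → ℝ, ∑ i, Function.extend f y 0 i * g i = ∑ l, y l * g (f l) := fun g => by
    rw [← Finset.sum_subset (Finset.subset_univ (Finset.univ.map ⟨f, hf⟩))]
    · simp [hf.extend_apply]
    · intro i _ hi
      rw [Function.extend_apply', Pi.zero_apply, zero_mul]
      rintro ⟨l, rfl⟩
      exact hi (by simp)
  have h1 := h (Function.extend f y 0)
  have h2 : Function.extend f y 0 ⬝ᵥ Function.extend f y 0 = y ⬝ᵥ y := by
    simp only [dotProduct]
    rw [hsum]
    simp [hf.extend_apply]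
  have h3 : Function.extend f y 0 ⬝ᵥ A *ᵥ Function.extend f y 0 = y ⬝ᵥ A.submatrix f f *ᵥ y := by
    simp only [dotProduct]
    rw [hsum]
    refine Finset.sum_congr rfl fun l _ => ?_
    congr 1
    simp only [mulVec, dotProduct, submatrix_apply]
    simp only [mul_comm (A _ _)]
    rw [hsum]
  rwa [h2, h3] at h1

open Polynomial in
theorem charpoly_graded_partialSchur {p : ℕ} {r : Fin p → ℕ} (hr : ∀ j, 1 ≤ r j)
    (M : Matrix (BlockIdx p r) (BlockIdx p r) ℝ) (e : Fin p → ℝ) :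
    (diagonal (fun i : BlockIdx p r => e i.1) * partialSchur p r M p *
      diagonal (fun i : BlockIdx p r => e i.1)).charpoly =
      ∏ j : Fin p, (e j ^ 2 • schurBlock p r M j).charpoly := by
  have htri : (diagonal (fun i : BlockIdx p r => e i.1) * partialSchur p r M p *
      diagonal (fun i : BlockIdx p r => e i.1)).BlockTriangular (fun i => (i.1 : ℕ)) := by
    intro i j hij
    rw [mul_diagonal, diagonal_mul, partialSchur_last_apply_of_ne M (ne_of_gt hij)]
    simp
  have himg : Finset.univ.image (fun i : BlockIdx p r => (i.1 : ℕ)) =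
      Finset.univ.image (fun j : Fin p => (j : ℕ)) := by
    ext k
    simp only [Finset.mem_image, Finset.mem_univ, true_and]
    constructor
    · rintro ⟨i, rfl⟩
      exact ⟨i.1, rfl⟩
    · rintro ⟨j, rfl⟩
      exact ⟨⟨j, ⟨0, hr j⟩⟩, rfl⟩
  rw [htri.charpoly, himg, Finset.prod_image (fun _ _ _ _ h => Fin.ext h)]
  refine Finset.prod_congr rfl fun j _ => ?_
  congr 1
  ext ⟨x, hx⟩ ⟨y, hy⟩
  rw [schurBlock_eq_submatrix_partialSchur]
  obtain rfl : x.1 = j := Fin.ext hx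
  have hy' : y.1 = x.1 := Fin.ext hy
  simp only [toSquareBlock_def, of_apply, mul_diagonal, diagonal_mul, Matrix.smul_apply,
    submatrix_apply, smul_eq_mul, hy']
  ring
/-- **Spectral localization for graded matrices.**  Let `M′` be symmetric positive definite on
`ℝⁿ` block-decomposed into `p` blocks of sizes `r j ≥ 1`, let `Ω(τ)` be the block-diagonal
matrix with entries `ε_j(τ) = τ₂⋯τ_j` on block `j`, and `M(τ) = Ω(τ) M′ Ω(τ)`.  Let `G_j` be
the iterated Schur complement blocks of `M′`.  For every `κ > 0` there are `δ, C > 0`,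
depending only on `p`, `r` and `κ`, such that whenever `‖M′‖ ≤ κ`, `‖M′⁻¹‖ ≤ κ` (Euclidean
operator norms) and all `τ_k ≤ t ≤ δ`, the spectrum of `M(τ)`, with multiplicity, consists of
eigenvalues `μ_{j,m}` with `|μ_{j,m} − ε_j(τ)² λ_{j,m}| ≤ C ε_j(τ)² t²`, where
`λ_{j,1} ≤ ⋯ ≤ λ_{j,r_j}` are the (positive) eigenvalues of `G_j`. -/
theorem graded_matrix_spectral_localization
    (p : ℕ) (hp : 1 ≤ p) (r : Fin p → ℕ) (hr : ∀ j, 1 ≤ r j)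
    (κ : ℝ) (hκ : 0 < κ) :
    ∃ δ > (0 : ℝ), ∃ C > (0 : ℝ),
      ∀ M' : Matrix (BlockIdx p r) (BlockIdx p r) ℝ, M'.PosDef →
        ‖Matrix.toEuclideanCLM (𝕜 := ℝ) M'‖ ≤ κ →
        ‖Matrix.toEuclideanCLM (𝕜 := ℝ) M'⁻¹‖ ≤ κ →
        ∀ (τ : Fin p → ℝ) (t : ℝ),
          (∀ k : Fin p, 0 < (k : ℕ) → 0 < τ k) →
          (∀ k : Fin p, 0 < (k : ℕ) → τ k ≤ t) →
          0 ≤ t → t ≤ δ →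
          ∃ (lam : (j : Fin p) → Fin (r j) → ℝ) (μ : (j : Fin p) → Fin (r j) → ℝ),
            (∀ j, Monotone (lam j)) ∧
            (∀ j m, 0 < lam j m) ∧
            (∀ j : Fin p,
              (schurBlock p r M' (j : ℕ)).charpoly.roots =
                Multiset.map (fun m => lam j m) Finset.univ.val) ∧
            ((Matrix.diagonal (fun i : BlockIdx p r => epsFactor p τ i.1) * M' *
                Matrix.diagonal (fun i : BlockIdx p r => epsFactor p τ i.1)).charpoly.roots =
              Multiset.map (fun i : BlockIdx p r => μ i.1 i.2) Finset.univ.val) ∧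
            (∀ (j : Fin p) (m : Fin (r j)),
              |μ j m - epsFactor p τ j ^ 2 * lam j m| ≤ C * epsFactor p τ j ^ 2 * t ^ 2) := by
  classical
  set n : ℝ := (Fintype.card (BlockIdx p r) : ℝ)
  set C₁ : ℝ := 1 + 2 * κ ^ 4 * n ^ 2 with hC₁
  set C₂ : ℝ := n ^ 4 * (κ + 1) ^ 2 * κ ^ 2 with hC₂
  have hC₁0 : 0 < C₁ := by positivity
  have hC₂0 : 0 ≤ C₂ := by positivity
  set C : ℝ := C₁ + C₂ + C₁ * C₂ with hC
  have hC0 : 0 < C := by positivity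
  refine ⟨1, one_pos, C * (1 + C) * κ, by positivity, ?_⟩
  intro M hM hMκ hMiκ τ t hτ hτt ht ht1
  obtain ⟨L, K, hL, hK, hLK, hKL, hML, hMK⟩ := exists_partialSchur_factorization M hM p
  set G := partialSchur p r M p with hGdef
  have hG : G.PosDef := by
    rw [hMK]
    exact hM.mul_mul_transpose_of_mul_eq_one hKL
  have hu := dotProduct_mulVec_le_of_norm_le hMκ
  have hl := hM.dotProduct_self_le_of_inv_le hκ (dotProduct_mulVec_le_of_norm_le hMiκ)
  obtain ⟨hGu, hGl⟩ := hL.form_bounds (N := p) (fun i => i.1.2) hK hML hMK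
    (fun i j hij => partialSchur_last_apply_of_ne M hij) hG.posSemidef hu hl
  have hLκ := abs_apply_le_of_conj_form_le hML hκ.le hu hGl
  have hKκ := abs_apply_le_of_conj_form_le hMK hκ.le hGu hl
  have hε := epsFactor_pos hτ
  have hw : ∀ i : BlockIdx p r, 0 < epsFactor p τ i.1 := fun i => hε i.1
  have hMw := hM.diagonal_mul_mul_diagonal hw
  have hGw := hG.diagonal_mul_mul_diagonal hw
  have hcmp := hL.graded_eigenvalues₀_le hK hLK hKL hML hG hκ.le hLκ hKκ ht ht1 hGu hGl hw
    (fun i j hij => epsFactor_le_mul hτ hτt ht1 hij) hMw hGw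
  have hB : ∀ j : Fin p, (schurBlock p r M j).PosDef := fun j => by
    rw [schurBlock_eq_submatrix_partialSchur]
    exact hG.submatrix Subtype.val_injective
  have hBκ : ∀ (j : Fin p) i, (hB j).isHermitian.eigenvalues i ≤ κ := fun j =>
    (hB j).isHermitian.eigenvalues_le_of_dotProduct_le fun x => by
      rw [schurBlock_eq_submatrix_partialSchur]
      exact submatrix_form_le hGu Subtype.val_injective x
  choose e he using fun j : Fin p =>
    (hB j).isHermitian.exists_monotone_eigenvalues (card_blkIdx p r j)
  have hroots : Multiset.map (fun i : BlockIdx p r =>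
      epsFactor p τ i.1 ^ 2 * (hB i.1).isHermitian.eigenvalues (e i.1 i.2)) Finset.univ.val =
      Multiset.map hGw.isHermitian.eigenvalues₀ Finset.univ.val := by
    have h1 := hGw.isHermitian.roots_charpoly_eq_eigenvalues₀
    rw [charpoly_graded_partialSchur hr M (epsFactor p τ)] at h1
    have h2 : ∏ j : Fin p, (epsFactor p τ j ^ 2 • schurBlock p r M j).charpoly =
        (Multiset.map (fun a => Polynomial.X - Polynomial.C a)
          (Multiset.map (fun i : BlockIdx p r => epsFactor p τ i.1 ^ 2 *
            (hB i.1).isHermitian.eigenvalues (e i.1 i.2)) Finset.univ.val)).prod := by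
      rw [Multiset.map_map]
      change _ = ∏ i : BlockIdx p r, _
      rw [Fintype.prod_sigma]
      refine Finset.prod_congr rfl fun j _ => ?_
      rw [(hB j).isHermitian.charpoly_smul_eq, ← (e j).prod_comp]
      rfl
    rw [h2, Polynomial.roots_multiset_prod_X_sub_C] at h1
    exact h1
  obtain ⟨σ, hσ⟩ := Fintype.exists_equiv_of_map_univ_eq hroots
  refine ⟨fun j m => (hB j).isHermitian.eigenvalues (e j m),
    fun j m => hMw.isHermitian.eigenvalues₀ (σ ⟨j, m⟩), he,
    fun j m => (hB j).eigenvalues_pos _, fun j => ?_, ?_, fun j m => ?_⟩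
  · rw [(hB j).isHermitian.roots_charpoly_eq_eigenvalues]
    rw [← Multiset.map_univ_val_equiv (e j), Multiset.map_map]
    rfl
  · rw [hMw.isHermitian.roots_charpoly_eq_eigenvalues₀]
    rw [← Multiset.map_univ_val_equiv σ, Multiset.map_map]
    rfl
  · obtain ⟨h1, h2⟩ := hcmp (σ ⟨j, m⟩)
    have hd := hσ ⟨j, m⟩
    dsimp only at hd ⊢
    rw [hd] at h1 h2
    have hlam := hBκ j (e j m)
    have hlam0 := (hB j).eigenvalues_pos (e j m)
    set lam := (hB j).isHermitian.eigenvalues (e j m)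
    set μ := hMw.isHermitian.eigenvalues₀ (σ ⟨j, m⟩)
    set d := epsFactor p τ j ^ 2 * lam with hddef
    have hd0 : 0 < d := mul_pos (pow_pos (hε j) 2) hlam0
    have ht2 : t ^ 2 ≤ 1 := pow_le_one₀ ht ht1
    have hfac : (1 + C₁ * t ^ 2) * (1 + C₂ * t ^ 2) ≤ 1 + C * t ^ 2 := by
      have : C₁ * C₂ * (t ^ 2 * t ^ 2) ≤ C₁ * C₂ * (t ^ 2 * 1) := by gcongr
      rw [hC]
      linarith
    have hfac0 : 0 < (1 + C₁ * t ^ 2) * (1 + C₂ * t ^ 2) := by positivity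
    have hμ0 : 0 ≤ μ := by
      by_contra! hneg
      have := mul_neg_of_pos_of_neg hfac0 hneg
      linarith
    have h1' : μ ≤ (1 + C * t ^ 2) * d := h1.trans (by gcongr)
    have h2' : d ≤ (1 + C * t ^ 2) * μ := h2.trans (by gcongr)
    have hμd : μ ≤ (1 + C) * d := h1'.trans (by
      gcongr
      exact mul_le_of_le_one_right hC0.le ht2)
    have hdκ : d ≤ epsFactor p τ j ^ 2 * κ := by rw [hddef]; gcongr
    have h3 : C * t ^ 2 * μ ≤ C * t ^ 2 * ((1 + C) * d) := by gcongr
    have h4 : C * t ^ 2 * d ≤ C * t ^ 2 * ((1 + C) * d) := by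
      gcongr
      nlinarith
    have h5 : C * t ^ 2 * ((1 + C) * d) ≤
        C * (1 + C) * κ * epsFactor p τ j ^ 2 * t ^ 2 := by
      calc _ ≤ C * t ^ 2 * ((1 + C) * (epsFactor p τ j ^ 2 * κ)) := by gcongr
        _ = _ := by ring
    rw [abs_le]
    constructor <;> linarith
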